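/- Let d ≥ 1, p ≥ 0 and r ≥ p. If v is a real polynomial in d variables of total degree at most p such that ∫_{(α+Ŝ)/(r+1)} v(x) dx = 0 for every multi-index α ∈ ℕ^d with |α| ≤ r (where (α+Ŝ)/(r+1) = {(α+x)/(r+1) : x ∈ Ŝ} is a sub-simplex of the unit simplex of edge length 1/(r+1)), then v is the zero polynomial. (Lemma 4.1 for the uniform sub-grid of the unit simplex, restricted to the translated sub-cells.) -/

import Mathlib

open MeasureTheory

/-- The closed unit simplex `Ŝ = {x ∈ ℝ^d : xᵢ ≥ 0, ∑ xᵢ ≤ 1}`. -/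
def unitSimplex (d : ℕ) : Set (Fin d → ℝ) :=
  {x | (∀ i, 0 ≤ x i) ∧ ∑ i, x i ≤ 1}

section

open MvPolynomial

/-- The algebra homomorphism `q ↦ q(x + c)` on polynomials. -/
noncomputable def translatePoly {σ : Type*} (c : σ → ℝ) :
    MvPolynomial σ ℝ →ₐ[ℝ] MvPolynomial σ ℝ :=
  aeval fun j => X j + C (c j)

theorem eval_translatePoly {σ : Type*} (c x : σ → ℝ) (q : MvPolynomial σ ℝ) :
    eval x (translatePoly c q) = eval (x + c) q := by
  rw [translatePoly, aeval_eq_bind₁]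
  change eval₂Hom _ _ _ = eval₂Hom _ _ _
  rw [eval₂Hom_bind₁]
  congr 2
  ext j
  simp

/-- `q` has degree at most `n`, and its difference along `c` is zero or has degree less
than `n`. -/
def DifferenceDegreeLT {σ : Type*} (c : σ → ℝ) (n : ℕ) (q : MvPolynomial σ ℝ) : Prop :=
  q.totalDegree ≤ n ∧
    (translatePoly c q - q = 0 ∨ (translatePoly c q - q).totalDegree < n)

namespace DifferenceDegreeLT

variable {σ : Type*} {c : σ → ℝ} {m n : ℕ} {a b : MvPolynomial σ ℝ}

theorem mono (h : m ≤ n) (ha : DifferenceDegreeLT c m a) : DifferenceDegreeLT c n a :=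
  ⟨ha.1.trans h, ha.2.imp_right fun h' => h'.trans_le h⟩

theorem const (c : σ → ℝ) (t : ℝ) : DifferenceDegreeLT c 0 (C t) := by
  refine ⟨by simp, Or.inl ?_⟩
  simp [translatePoly]

theorem var (c : σ → ℝ) (i : σ) : DifferenceDegreeLT c 1 (X i) := by
  refine ⟨by simp, Or.inr ?_⟩
  simp [translatePoly]

theorem add (ha : DifferenceDegreeLT c n a) (hb : DifferenceDegreeLT c n b) :
    DifferenceDegreeLT c n (a + b) := by
  refine ⟨(totalDegree_add _ _).trans (max_le ha.1 hb.1), ?_⟩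
  have e : translatePoly c (a + b) - (a + b) =
      (translatePoly c a - a) + (translatePoly c b - b) := by
    rw [map_add]; ring
  rw [e]
  rcases ha.2 with h | h
  · rw [h, zero_add]; exact hb.2
  · rcases hb.2 with h' | h'
    · rw [h', add_zero]; exact Or.inr h
    · exact Or.inr ((totalDegree_add _ _).trans_lt (max_lt h h'))

theorem totalDegree_translatePoly_le (ha : DifferenceDegreeLT c n a) :
    (translatePoly c a).totalDegree ≤ n := by
  have e : translatePoly c a = (translatePoly c a - a) + a := by ring
  rcases ha.2 with h | h
  · rw [sub_eq_zero.mp h]; exact ha.1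
  · rw [e]
    exact (totalDegree_add _ _).trans (max_le h.le ha.1)

theorem mul (ha : DifferenceDegreeLT c m a) (hb : DifferenceDegreeLT c n b) :
    DifferenceDegreeLT c (m + n) (a * b) := by
  refine ⟨(totalDegree_mul _ _).trans (add_le_add ha.1 hb.1), ?_⟩
  have e : translatePoly c (a * b) - a * b =
      (translatePoly c a - a) * translatePoly c b + a * (translatePoly c b - b) := by
    rw [map_mul]; ring
  have h₁ := totalDegree_mul (translatePoly c a - a) (translatePoly c b)
  have h₂ := totalDegree_mul a (translatePoly c b - b)
  have h₃ := hb.totalDegree_translatePoly_le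
  have h₄ := ha.1
  rw [e]
  rcases ha.2 with h | h
  · rw [h, zero_mul, zero_add]
    rcases hb.2 with h' | h'
    · left; rw [h', mul_zero]
    · right; omega
  · right
    rcases hb.2 with h' | h'
    · rw [h', mul_zero, add_zero]; omega
    · exact (totalDegree_add _ _).trans_lt (max_lt (by omega) (by omega))

theorem monomial_one (c : σ → ℝ) (s : σ →₀ ℕ) :
    DifferenceDegreeLT c s.degree (monomial s 1) := by
  induction s using Finsupp.induction_linear with
  | zero => simpa using const c 1
  | add f g hf hg =>
    have e : (monomial (f + g) 1 : MvPolynomial σ ℝ) = monomial f 1 * monomial g 1 := by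
      simp [monomial_mul]
    rw [e, map_add]
    exact hf.mul hg
  | single i k =>
    rw [Finsupp.degree_single, ← X_pow_eq_monomial]
    induction k with
    | zero => simpa using const c 1
    | succ k ih =>
      rw [pow_succ]
      exact ih.mul (var c i)

theorem of_totalDegree_le (c : σ → ℝ) {q : MvPolynomial σ ℝ} (hq : q.totalDegree ≤ n) :
    DifferenceDegreeLT c n q := by
  rw [q.as_sum]
  refine Finset.sum_induction _ (DifferenceDegreeLT c n) (fun _ _ => add)
    (by simpa using (const c 0).mono (Nat.zero_le n)) fun s hs => ?_
  have e : monomial s (coeff s q) = C (coeff s q) * monomial s 1 := by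
    rw [C_mul_monomial, mul_one]
  rw [e]
  refine ((const c _).mul (monomial_one c s)).mono ?_
  rw [zero_add]
  exact (le_totalDegree hs).trans hq

end DifferenceDegreeLT

theorem totalDegree_translatePoly_sub_le {σ : Type*} (c : σ → ℝ) {n : ℕ}
    {q : MvPolynomial σ ℝ} (hq : q.totalDegree ≤ n + 1) :
    (translatePoly c q - q).totalDegree ≤ n := by
  rcases (DifferenceDegreeLT.of_totalDegree_le c hq).2 with h | h
  · simp [h]
  · omega

/-- A polynomial invariant under a nonzero translation along each axis is constant. -/
theorem eq_C_of_translatePoly_single_eq {d : ℕ} {h : ℝ} (hh : h ≠ 0)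
    {q : MvPolynomial (Fin d) ℝ} (hq : ∀ i, translatePoly (Pi.single i h) q = q) :
    q = C (eval 0 q) := by
  have step (x : Fin d → ℝ) (i : Fin d) (k : ℕ) :
      eval (x + Pi.single i (h * k)) q = eval x q := by
    induction k with
    | zero => simp
    | succ k ih =>
      rw [← ih, Nat.cast_succ, mul_add, mul_one, Pi.single_add, ← add_assoc,
        ← eval_translatePoly, hq i]
  have lattice (α : Fin d → ℕ) (s : Finset (Fin d)) :
      eval (∑ i ∈ s, Pi.single i (h * α i)) q = eval 0 q := by
    induction s using Finset.induction_on with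
    | empty => simp
    | insert i s his ih => rw [Finset.sum_insert his, add_comm, step, ih]
  refine funext_set (fun _ => Set.range fun k : ℕ => h * k) (fun _ => ?_) fun x hx => ?_
  · exact Set.infinite_range_of_injective fun a b hab =>
      Nat.cast_injective (mul_left_cancel₀ hh hab)
  · choose α hα using fun i => hx i (Set.mem_univ i)
    have hx' : ∑ i, Pi.single i (h * α i) = x := by
      rw [Finset.univ_sum_single fun i => h * (α i : ℝ)]
      exact funext hα
    rw [eval_C, ← hx', lattice]

theorem isCompact_unitSimplex (d : ℕ) : IsCompact (unitSimplex d) := by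
  refine (isCompact_Icc (a := (0 : Fin d → ℝ)) (b := 1)).of_isClosed_subset ?_ ?_
  · refine IsClosed.inter (s₂ := {x : Fin d → ℝ | ∑ i, x i ≤ 1}) ?_
      (isClosed_le (by fun_prop) (by fun_prop))
    change IsClosed {x : Fin d → ℝ | ∀ i, 0 ≤ x i}
    rw [Set.ofPred_forall]
    exact isClosed_iInter fun i => isClosed_le continuous_const (continuous_apply i)
  · rintro x ⟨h₀, h₁⟩
    exact ⟨h₀, fun i => (Finset.single_le_sum (fun j _ => h₀ j) (Finset.mem_univ i)).trans h₁⟩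

/-- The sub-cell `(α + Ŝ)/(r+1)`. -/
def subgridCell (d r : ℕ) (α : Fin d → ℕ) : Set (Fin d → ℝ) :=
  (fun y : Fin d → ℝ => fun i => ((α i : ℝ) + y i) / (r + 1)) '' unitSimplex d

theorem isCompact_subgridCell (d r : ℕ) (α : Fin d → ℕ) : IsCompact (subgridCell d r α) :=
  (isCompact_unitSimplex d).image (by fun_prop)

theorem subgridCell_add_single (d r : ℕ) (α : Fin d → ℕ) (i : Fin d) :
    subgridCell d r (α + Pi.single i 1) =
      (fun x => x + Pi.single i (1 / ((r : ℝ) + 1))) '' subgridCell d r α := by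
  rw [subgridCell, subgridCell, Set.image_image]
  refine Set.image_congr fun y _ => funext fun j => ?_
  rcases eq_or_ne j i with rfl | hj
  · simp; ring
  · simp [hj]

theorem setIntegral_eval_translatePoly {d : ℕ} (c : Fin d → ℝ) (s : Set (Fin d → ℝ))
    (q : MvPolynomial (Fin d) ℝ) :
    ∫ x in s, eval x (translatePoly c q) = ∫ x in (fun x => x + c) '' s, eval x q := by
  rw [(measurePreserving_add_right volume c).setIntegral_image_emb
    (measurableEmbedding_addRight c)]
  simp only [eval_translatePoly]

theorem volume_real_subgridCell_zero_ne_zero (d r : ℕ) :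
    volume.real (subgridCell d r 0) ≠ 0 := by
  have hr : (0 : ℝ) < r + 1 := by positivity
  let U : Set (Fin d → ℝ) := (⋂ i, {x | 0 < x i}) ∩ {x | (∑ i, x i) * (r + 1) < 1}
  have hU : IsOpen U := (isOpen_iInter_of_finite fun i =>
    isOpen_lt (by fun_prop) (by fun_prop)).inter (isOpen_lt (by fun_prop) (by fun_prop))
  have hne : U.Nonempty := by
    refine ⟨fun _ => 1 / ((d + 1) * (r + 1)), Set.mem_iInter.mpr fun _ => ?_, ?_⟩
    · simp only [Set.mem_ofPred_eq]; positivity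
    · simp only [Set.mem_ofPred_eq, Finset.sum_const, Finset.card_univ, Fintype.card_fin,
        nsmul_eq_mul]
      have e : (d : ℝ) * (1 / ((d + 1) * (r + 1))) * (r + 1) = d / (d + 1) := by
        field_simp
      rw [e, div_lt_one (by positivity)]
      linarith
  have hsub : U ⊆ subgridCell d r 0 := by
    rintro x ⟨h₀, h₁⟩
    refine ⟨fun i => x i * (r + 1), ⟨fun i => ?_, ?_⟩, funext fun i => ?_⟩
    · exact (mul_pos (Set.mem_iInter.mp h₀ i) hr).le
    · rw [← Finset.sum_mul]; exact h₁.le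
    · simp [hr.ne']
  exact (ENNReal.toReal_pos ((hU.measure_pos volume hne).trans_le (measure_mono hsub)).ne'
    (isCompact_subgridCell d r 0).measure_lt_top.ne).ne'

theorem eq_zero_of_setIntegral_subgridCell_eq_zero {d r : ℕ} (p : ℕ)
    {v : MvPolynomial (Fin d) ℝ} (hdeg : v.totalDegree ≤ p)
    (hzero : ∀ α : Fin d → ℕ, (∑ i, α i) ≤ p → ∫ x in subgridCell d r α, eval x v = 0) :
    v = 0 := by
  have of_eq_C {w : MvPolynomial (Fin d) ℝ} (h : ∫ x in subgridCell d r 0, eval x w = 0)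
      (hw : w = C (eval 0 w)) : w = 0 := by
    rw [hw] at h ⊢
    simp only [eval_C, setIntegral_const, smul_eq_mul, mul_eq_zero,
      volume_real_subgridCell_zero_ne_zero, false_or] at h
    rw [h, C_0]
  induction p generalizing v with
  | zero =>
    refine of_eq_C (hzero 0 (by simp)) ?_
    have h := totalDegree_eq_zero_iff_eq_C.mp (Nat.le_zero.mp hdeg)
    rw [h, eval_C]
  | succ p ih =>
    have hr : (1 / ((r : ℝ) + 1)) ≠ 0 := by positivity
    refine of_eq_C (hzero 0 (by simp))
      (eq_C_of_translatePoly_single_eq hr fun i => sub_eq_zero.mp ?_)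
    have hint (q : MvPolynomial (Fin d) ℝ) (α : Fin d → ℕ) :
        IntegrableOn (fun x => eval x q) (subgridCell d r α) :=
      q.continuous_eval.continuousOn.integrableOn_compact (isCompact_subgridCell d r α)
    refine ih (totalDegree_translatePoly_sub_le _ hdeg) fun α hα => ?_
    simp only [map_sub]
    rw [integral_sub (hint _ α) (hint _ α), setIntegral_eval_translatePoly,
      ← subgridCell_add_single, hzero α (by omega), hzero (α + Pi.single i 1) ?_, sub_zero]
    simp only [Pi.add_apply, Finset.sum_add_distrib, Finset.sum_pi_single', Finset.mem_univ,
      if_true]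
    omega

end

/-- Lemma 4.1 (on the translated sub-cells): let `d ≥ 1`, `p ≥ 0` and `r ≥ p`. If a real
polynomial `v` in `d` variables of total degree at most `p` has vanishing integral over every
scaled sub-simplex `(α + Ŝ)/(r+1)` for all multi-indices `α ∈ ℕ^d` with `|α| ≤ r`,
then `v = 0`. -/
theorem subgrid_averages_injective_on_polynomials
    (d p r : ℕ) (hd : 1 ≤ d) (hr : p ≤ r)
    (v : MvPolynomial (Fin d) ℝ) (hdeg : v.totalDegree ≤ p)
    (hzero : ∀ α : Fin d → ℕ, (∑ i, α i) ≤ r →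
      ∫ x in (fun y : Fin d → ℝ => fun i => ((α i : ℝ) + y i) / (r + 1)) '' unitSimplex d,
        MvPolynomial.eval x v ∂volume = 0) :
    v = 0 := by
  exact eq_zero_of_setIntegral_subgridCell_eq_zero p hdeg fun α hα => hzero α (hα.trans hr)
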